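/- SO(3) is not homeomorphic to SO(2) × S²: there is no homeomorphism between the group of 3×3 real special orthogonal matrices (with its subspace topology) and the product of the group of 2×2 real special orthogonal matrices with the unit 2-sphere in ℝ³. -/

import Mathlib

open Matrix RealInnerProductSpace

noncomputable section

/-- Euclidean 3-space. -/
abbrev E3 := EuclideanSpace ℝ (Fin 3)

/-- The special orthogonal group SO(3): the subgroup of the real orthogonal group
(3×3 real matrices whose transpose is their inverse) consisting of matrices of
determinant 1. -/
def SO3 : Subgroup (Matrix.unitaryGroup (Fin 3) ℝ) where
  carrier := {A | (A : Matrix (Fin 3) (Fin 3) ℝ).det = 1}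
  one_mem' := by simp
  mul_mem' := by
    intro a b ha hb
    simp only [Set.mem_setOf_eq, Submonoid.coe_mul, Matrix.det_mul] at *
    rw [ha, hb, mul_one]
  inv_mem' := by
    intro a ha
    simp only [Set.mem_setOf_eq] at *
    have h : ((a⁻¹ : Matrix.unitaryGroup (Fin 3) ℝ) : Matrix (Fin 3) (Fin 3) ℝ)
        = star (a : Matrix (Fin 3) (Fin 3) ℝ) := rfl
    rw [h, Matrix.star_eq_conjTranspose, Matrix.det_conjTranspose]
    simp [ha]

/-- The action of an element of SO(3) on Euclidean 3-space, by matrix-vector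
multiplication. -/
def act (g : SO3) (v : E3) : E3 :=
  (EuclideanSpace.equiv (Fin 3) ℝ).symm
    (((g : Matrix.unitaryGroup (Fin 3) ℝ) : Matrix (Fin 3) (Fin 3) ℝ).mulVec
      (EuclideanSpace.equiv (Fin 3) ℝ v))

/-- The north pole p = (0,1,0). -/
def pY : E3 := (EuclideanSpace.equiv (Fin 3) ℝ).symm ![0, 1, 0]

/-- The tangent vector t = (1,0,0). -/
def tX : E3 := (EuclideanSpace.equiv (Fin 3) ℝ).symm ![1, 0, 0]

/-- The set R_Y of rotations about the Y axis, i.e. elements of SO(3) fixing p = (0,1,0). -/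
def RY : Set SO3 := {h | act h pY = pY}

/-- The orbit Ω(g) of g under left multiplication by rotations about the Y axis. -/
def orbit (g : SO3) : Set SO3 := {g' | ∃ h ∈ RY, g' = h * g}

/-- The unit 2-sphere in Euclidean 3-space. -/
def S2 := {q : E3 // ‖q‖ = 1}

instance : TopologicalSpace S2 := instTopologicalSpaceSubtype

instance : CoeOut S2 E3 := ⟨Subtype.val⟩

/-- The special orthogonal group SO(2): 2×2 real orthogonal matrices of determinant 1. -/
def SO2 : Subgroup (Matrix.unitaryGroup (Fin 2) ℝ) where
  carrier := {A | (A : Matrix (Fin 2) (Fin 2) ℝ).det = 1}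
  one_mem' := by simp
  mul_mem' := by
    intro a b ha hb
    simp only [Set.mem_setOf_eq, Submonoid.coe_mul, Matrix.det_mul] at *
    rw [ha, hb, mul_one]
  inv_mem' := by
    intro a ha
    simp only [Set.mem_setOf_eq] at *
    have h : ((a⁻¹ : Matrix.unitaryGroup (Fin 2) ℝ) : Matrix (Fin 2) (Fin 2) ℝ)
        = star (a : Matrix (Fin 2) (Fin 2) ℝ) := rfl
    rw [h, Matrix.star_eq_conjTranspose, Matrix.det_conjTranspose]
    simp [ha]

/-- Two real functions on a preconnected space with the same image under the circle exponential
differ by a constant. -/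
theorem sub_eq_sub_of_circle_exp_eq {X : Type*} [TopologicalSpace X] [PreconnectedSpace X]
    {g h : X → ℝ} (hg : Continuous g) (hh : Continuous h)
    (hgh : ∀ x, Circle.exp (g x) = Circle.exp (h x)) (x y : X) : g x - h x = g y - h y := by
  have key : g = fun z => h z + (g x - h x) := by
    refine Circle.isCoveringMap_exp.eq_of_comp_eq hg (by fun_prop) ?_ x (by ring)
    funext z
    simp [Circle.exp_add, hgh]
  have := congrFun key y
  linarith

/-- A circle-valued map on a nonempty convex set has a continuous logarithm. -/
theorem Convex.exists_circle_exp_comp_eq {E : Type*} [AddCommGroup E] [Module ℝ E]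
    [TopologicalSpace E] [IsTopologicalAddGroup E] [ContinuousSMul ℝ E] [LocallyConvexSpace ℝ E]
    {s : Set E} (hs : Convex ℝ s) (hne : s.Nonempty) {f : s → Circle} (hf : Continuous f) :
    ∃ F : s → ℝ, Continuous F ∧ ∀ x, Circle.exp (F x) = f x := by
  have := hs.contractibleSpace hne
  have := hs.locallyPathConnectedSpace
  obtain ⟨x, hx⟩ := hne
  obtain ⟨F, ⟨-, hF⟩, -⟩ := Circle.isCoveringMap_exp.existsUnique_continuousMap_lifts
    ⟨f, hf⟩ ⟨x, hx⟩ (f ⟨x, hx⟩ : ℂ).arg (Circle.exp_arg _)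
  exact ⟨F, F.continuous, congrFun hF⟩

/-- A vector is determined up to sign by its outer product with itself. -/
theorem eq_or_eq_neg_of_vecMulVec_self_eq {n : Type*} {q q' : n → ℝ}
    (h : Matrix.vecMulVec q q = Matrix.vecMulVec q' q') : q = q' ∨ q = -q' := by
  have e : ∀ i j, q i * q j = q' i * q' j := fun i j => congrFun₂ h i j
  by_cases h0 : q' = 0
  · left
    funext i
    simpa [h0] using e i i
  obtain ⟨i, hi⟩ := Function.ne_iff.mp h0
  rcases mul_self_eq_mul_self_iff.mp (e i i) with hq | hq
  · left
    funext j
    have := e i j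
    rw [hq] at this
    exact mul_left_cancel₀ hi this
  · right
    funext j
    have := e i j
    rw [hq, neg_mul, ← mul_neg] at this
    exact neg_eq_iff_eq_neg.mp (mul_left_cancel₀ hi this)

/-- A rank-one real matrix with trace one is the outer product of a vector with itself. -/
theorem exists_vecMulVec_self_eq {n : Type*} [Fintype n] {K : Matrix n n ℝ}
    (hK : ∀ i j k, K i i * K j k = K i j * K i k) (htr : K.trace = 1) :
    ∃ q : n → ℝ, Matrix.vecMulVec q q = K := by
  obtain ⟨i, -, hi⟩ : ∃ i ∈ Finset.univ, 0 < K i i := by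
    apply Finset.exists_lt_of_sum_lt
    have : ∑ i, K i i = 1 := htr
    simp [this]
  refine ⟨fun j => K i j / √(K i i), ?_⟩
  ext j k
  rw [Matrix.vecMulVec_apply, div_mul_div_comm, Real.mul_self_sqrt hi.le, ← hK,
    mul_div_cancel_left₀ _ hi.ne']

/-- The rotation matrix of the quaternion `q 0 + q 1 i + q 2 j + q 3 k`. -/
def quaternionMatrix (q : Fin 4 → ℝ) : Matrix (Fin 3) (Fin 3) ℝ :=
  !![q 0 ^ 2 + q 1 ^ 2 - q 2 ^ 2 - q 3 ^ 2, 2 * (q 1 * q 2 - q 0 * q 3),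
      2 * (q 1 * q 3 + q 0 * q 2);
    2 * (q 1 * q 2 + q 0 * q 3), q 0 ^ 2 - q 1 ^ 2 + q 2 ^ 2 - q 3 ^ 2,
      2 * (q 2 * q 3 - q 0 * q 1);
    2 * (q 1 * q 3 - q 0 * q 2), 2 * (q 2 * q 3 + q 0 * q 1),
      q 0 ^ 2 - q 1 ^ 2 - q 2 ^ 2 + q 3 ^ 2]

/-- The outer product of a unit quaternion with itself, in terms of its rotation matrix. -/
def quaternionOuter (M : Matrix (Fin 3) (Fin 3) ℝ) : Matrix (Fin 4) (Fin 4) ℝ :=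
  (4⁻¹ : ℝ) • !![1 + M 0 0 + M 1 1 + M 2 2, M 2 1 - M 1 2, M 0 2 - M 2 0, M 1 0 - M 0 1;
    M 2 1 - M 1 2, 1 + M 0 0 - M 1 1 - M 2 2, M 0 1 + M 1 0, M 0 2 + M 2 0;
    M 0 2 - M 2 0, M 0 1 + M 1 0, 1 - M 0 0 + M 1 1 - M 2 2, M 1 2 + M 2 1;
    M 1 0 - M 0 1, M 0 2 + M 2 0, M 1 2 + M 2 1, 1 - M 0 0 - M 1 1 + M 2 2]

theorem quaternionMatrix_mem_unitaryGroup {q : Fin 4 → ℝ} (h : ∑ i, q i ^ 2 = 1) :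
    quaternionMatrix q ∈ Matrix.unitaryGroup (Fin 3) ℝ := by
  have h2 : (∑ i, q i ^ 2) ^ 2 = 1 := by rw [h, one_pow]
  rw [Fin.sum_univ_four] at h2
  rw [Matrix.mem_unitaryGroup_iff, Matrix.star_eq_conjTranspose]
  ext i j
  fin_cases i <;> fin_cases j <;>
    simp [quaternionMatrix, Matrix.mul_apply, Fin.sum_univ_three] <;>
    first | linear_combination h2 | ring

theorem det_quaternionMatrix {q : Fin 4 → ℝ} (h : ∑ i, q i ^ 2 = 1) :
    (quaternionMatrix q).det = 1 := by
  have h3 : (∑ i, q i ^ 2) ^ 3 = 1 := by rw [h, one_pow]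
  rw [Fin.sum_univ_four] at h3
  simp only [quaternionMatrix, Matrix.det_fin_three, Matrix.of_apply, Matrix.cons_val',
    Matrix.cons_val_zero, Matrix.cons_val_one, Matrix.cons_val, Matrix.cons_val_fin_one]
  linear_combination h3

/-- The rotation given by a unit quaternion. -/
def quaternionRotation (q : Fin 4 → ℝ) (h : ∑ i, q i ^ 2 = 1) : SO3 :=
  ⟨⟨quaternionMatrix q, quaternionMatrix_mem_unitaryGroup h⟩, det_quaternionMatrix h⟩

theorem quaternionMatrix_neg (q : Fin 4 → ℝ) : quaternionMatrix (-q) = quaternionMatrix q := by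
  simp [quaternionMatrix]

theorem quaternionOuter_quaternionMatrix {q : Fin 4 → ℝ} (h : ∑ i, q i ^ 2 = 1) :
    quaternionOuter (quaternionMatrix q) = Matrix.vecMulVec q q := by
  rw [Fin.sum_univ_four] at h
  ext i j
  fin_cases i <;> fin_cases j <;>
    simp [quaternionMatrix, quaternionOuter, Matrix.vecMulVec_apply] <;> linarith

theorem quaternionMatrix_eq_of_vecMulVec_eq {q : Fin 4 → ℝ} {M : Matrix (Fin 3) (Fin 3) ℝ}
    (h : Matrix.vecMulVec q q = quaternionOuter M) : quaternionMatrix q = M := by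
  have e : ∀ i j, q i * q j = quaternionOuter M i j := fun i j => congrFun₂ h i j
  ext i j
  fin_cases i <;> fin_cases j <;>
    simp [quaternionMatrix, pow_two, e] <;> simp [quaternionOuter] <;> ring

theorem trace_quaternionOuter (M : Matrix (Fin 3) (Fin 3) ℝ) : (quaternionOuter M).trace = 1 := by
  simp [quaternionOuter, Matrix.trace, Fin.sum_univ_four]
  ring

/-- Unit quaternions giving the same rotation are equal up to sign. -/
theorem eq_or_eq_neg_of_quaternionMatrix_eq {q q' : Fin 4 → ℝ} (h : ∑ i, q i ^ 2 = 1)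
    (h' : ∑ i, q' i ^ 2 = 1) (heq : quaternionMatrix q = quaternionMatrix q') :
    q = q' ∨ q = -q' := by
  apply eq_or_eq_neg_of_vecMulVec_self_eq
  rw [← quaternionOuter_quaternionMatrix h, heq, quaternionOuter_quaternionMatrix h']

set_option maxHeartbeats 2000000 in
theorem SO3.quaternionOuter_mul_eq (A : SO3) (i j k : Fin 4) :
    quaternionOuter A.1.1 i i * quaternionOuter A.1.1 j k =
      quaternionOuter A.1.1 i j * quaternionOuter A.1.1 i k := by
  have hdet : A.1.1.det = 1 := A.2
  generalize hM : A.1.1 = M at hdet ⊢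
  have hMl : M * star M = 1 := hM ▸ Matrix.mem_unitaryGroup_iff.mp A.1.2
  have hMr : star M * M = 1 := hM ▸ Matrix.mem_unitaryGroup_iff'.mp A.1.2
  have hadj : M.adjugate = star M := by
    calc M.adjugate = M.adjugate * (M * star M) := by rw [hMl, mul_one]
      _ = star M := by rw [← mul_assoc, Matrix.adjugate_mul, hdet, one_smul, one_mul]
  have l : ∀ i j, (M * star M) i j = (1 : Matrix (Fin 3) (Fin 3) ℝ) i j := fun i j => by rw [hMl]
  have r : ∀ i j, (star M * M) i j = (1 : Matrix (Fin 3) (Fin 3) ℝ) i j := fun i j => by rw [hMr]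
  have c : ∀ i j, M.adjugate i j = star M i j := fun i j => by rw [hadj]
  simp only [Fin.forall_fin_succ, Matrix.mul_apply, Fin.sum_univ_three, Matrix.star_apply,
    Matrix.one_apply, Matrix.adjugate_fin_three] at l r c
  simp at l r c
  fin_cases i <;> fin_cases j <;> fin_cases k <;> simp [quaternionOuter] <;> linarith

/-- Every rotation comes from a unit quaternion with nonnegative real part. -/
theorem exists_quaternionRotation_eq (A : SO3) :
    ∃ (q : Fin 4 → ℝ) (h : ∑ i, q i ^ 2 = 1), 0 ≤ q 0 ∧ quaternionRotation q h = A := by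
  obtain ⟨q, hq⟩ := exists_vecMulVec_self_eq (SO3.quaternionOuter_mul_eq A) (trace_quaternionOuter _)
  have h : ∑ i, q i ^ 2 = 1 := by
    rw [← trace_quaternionOuter A.1.1, ← hq]
    simp [Matrix.trace, Matrix.vecMulVec_apply, pow_two]
  have hqA := quaternionMatrix_eq_of_vecMulVec_eq hq
  rcases le_total 0 (q 0) with h0 | h0
  · exact ⟨q, h, h0, Subtype.ext (Subtype.ext hqA)⟩
  · exact ⟨-q, by simpa using h, by simpa using h0,
      Subtype.ext (Subtype.ext ((quaternionMatrix_neg q).trans hqA))⟩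

/-- The unit quaternion with imaginary part `v` and nonnegative real part. -/
def ballQuaternion (v : E3) : Fin 4 → ℝ := Fin.cons √(1 - ‖v‖ ^ 2) v

theorem sum_ballQuaternion_sq {v : E3} (hv : v ∈ Metric.closedBall (0 : E3) 1) :
    ∑ i, ballQuaternion v i ^ 2 = 1 := by
  have h1 : ‖v‖ ≤ 1 := by simpa using hv
  have h2 : 0 ≤ 1 - ‖v‖ ^ 2 := by nlinarith [norm_nonneg v]
  rw [Fin.sum_univ_succ]
  simp only [ballQuaternion, Fin.cons_zero, Fin.cons_succ, Real.sq_sqrt h2,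
    ← EuclideanSpace.real_norm_sq_eq, sub_add_cancel]

theorem continuous_ballQuaternion : Continuous ballQuaternion := by
  unfold ballQuaternion
  fun_prop

/-- The parametrisation of `SO(3)` by the closed unit ball, identifying antipodal boundary
points. -/
def ballRotation (v : Metric.closedBall (0 : E3) 1) : SO3 :=
  quaternionRotation (ballQuaternion v) (sum_ballQuaternion_sq v.2)

theorem continuous_ballRotation : Continuous ballRotation := by
  refine Continuous.subtype_mk (Continuous.subtype_mk ?_ _) _
  have : ∀ i, Continuous fun v : Metric.closedBall (0 : E3) 1 => ballQuaternion v i := fun i =>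
    (continuous_apply i).comp (continuous_ballQuaternion.comp continuous_subtype_val)
  refine continuous_matrix fun i j => ?_
  fin_cases i <;> fin_cases j <;> simp [quaternionMatrix] <;> fun_prop

theorem ballRotation_surjective : Function.Surjective ballRotation := by
  intro A
  obtain ⟨q, h, h0, rfl⟩ := exists_quaternionRotation_eq A
  let v : E3 := WithLp.toLp 2 (Fin.tail q)
  have hv : ‖v‖ ^ 2 = 1 - q 0 ^ 2 := by
    rw [Fin.sum_univ_succ] at h
    rw [EuclideanSpace.real_norm_sq_eq]
    exact eq_sub_of_add_eq' h
  have hv1 : v ∈ Metric.closedBall (0 : E3) 1 := by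
    rw [mem_closedBall_zero_iff]
    nlinarith [sq_nonneg (q 0)]
  have hq : ballQuaternion v = q := by
    rw [ballQuaternion, hv, sub_sub_cancel, Real.sqrt_sq h0]
    exact Fin.cons_self_tail q
  refine ⟨⟨v, hv1⟩, ?_⟩
  simp only [ballRotation, hq]

theorem ballQuaternion_neg {v : E3} (hv : ‖v‖ = 1) : ballQuaternion (-v) = -ballQuaternion v := by
  ext i
  refine Fin.cases ?_ (fun i => ?_) i <;> simp [ballQuaternion, hv]

theorem eq_or_eq_neg_of_ballRotation_eq {v w : Metric.closedBall (0 : E3) 1}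
    (h : ballRotation v = ballRotation w) : v = w ∨ ‖(w : E3)‖ = 1 ∧ (v : E3) = -w := by
  have hM : quaternionMatrix (ballQuaternion v) = quaternionMatrix (ballQuaternion w) :=
    congrArg (fun A : SO3 => A.1.1) h
  rcases eq_or_eq_neg_of_quaternionMatrix_eq (sum_ballQuaternion_sq v.2)
    (sum_ballQuaternion_sq w.2) hM with hq | hq
  · left
    ext i
    exact congrFun hq i.succ
  · right
    have h0 : √(1 - ‖(v : E3)‖ ^ 2) = -√(1 - ‖(w : E3)‖ ^ 2) := congrFun hq 0
    have hw : √(1 - ‖(w : E3)‖ ^ 2) = 0 := by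
      linarith [Real.sqrt_nonneg (1 - ‖(v : E3)‖ ^ 2), Real.sqrt_nonneg (1 - ‖(w : E3)‖ ^ 2)]
    have hw1 : ‖(w : E3)‖ ≤ 1 := mem_closedBall_zero_iff.mp w.2
    refine ⟨hw1.antisymm ?_, ?_⟩
    · have := Real.sqrt_eq_zero'.mp hw
      nlinarith [norm_nonneg (w : E3)]
    · ext i
      exact congrFun hq i.succ

theorem ballRotation_eq_of_eq_neg {v w : Metric.closedBall (0 : E3) 1} (hw : ‖(w : E3)‖ = 1)
    (h : (v : E3) = -w) : ballRotation v = ballRotation w := by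
  apply Subtype.ext
  apply Subtype.ext
  change quaternionMatrix (ballQuaternion v) = quaternionMatrix (ballQuaternion w)
  rw [h, ballQuaternion_neg hw, quaternionMatrix_neg]

/-- Every continuous circle-valued map on `SO(3)` has a continuous logarithm. -/
theorem SO3.exists_circle_exp_comp_eq {f : SO3 → Circle} (hf : Continuous f) :
    ∃ g : SO3 → ℝ, Continuous g ∧ ∀ A, Circle.exp (g A) = f A := by
  obtain ⟨F, hF, hFf⟩ := (convex_closedBall (0 : E3) 1).exists_circle_exp_comp_eq
    ⟨0, by simp⟩ (hf.comp continuous_ballRotation)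
  have : PreconnectedSpace (Metric.sphere (0 : E3) 1) :=
    Subtype.preconnectedSpace (isPreconnected_sphere (by simp [← Module.finrank_eq_rank]) 0 1)
  let ι : Metric.sphere (0 : E3) 1 → Metric.closedBall (0 : E3) 1 :=
    Set.inclusion Metric.sphere_subset_closedBall
  have hι : Continuous ι := continuous_inclusion Metric.sphere_subset_closedBall
  have hanti : ∀ x : Metric.sphere (0 : E3) 1, F (ι (-x)) = F (ι x) := by
    intro x
    have := sub_eq_sub_of_circle_exp_eq (g := fun x => F (ι (-x))) (h := fun x => F (ι x))
      (by fun_prop) (by fun_prop) (fun x => by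
        rw [hFf, hFf]
        exact congrArg f (ballRotation_eq_of_eq_neg (mem_sphere_zero_iff_norm.mp x.2) rfl)) x (-x)
    simp only [neg_neg] at this
    linarith
  have hfib : ∀ v w, ballRotation v = ballRotation w → F v = F w := by
    intro v w h
    rcases eq_or_eq_neg_of_ballRotation_eq h with rfl | ⟨hw, hvw⟩
    · rfl
    · have hv : v = ι (-⟨w, mem_sphere_zero_iff_norm.mpr hw⟩) := Subtype.ext hvw
      rw [hv, hanti]
  have hquot : Topology.IsQuotientMap ballRotation :=
    continuous_ballRotation.isClosedMap.isQuotientMap continuous_ballRotation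
      ballRotation_surjective
  have hlift : (F ∘ Function.surjInv ballRotation_surjective) ∘ ballRotation = F := by
    funext v
    exact hfib _ _ (Function.surjInv_eq ballRotation_surjective _)
  refine ⟨F ∘ Function.surjInv ballRotation_surjective, ?_, fun A => ?_⟩
  · rw [hquot.continuous_iff, hlift]
    exact hF
  · rw [Function.comp_apply, hFf, Function.comp_apply,
      Function.surjInv_eq ballRotation_surjective]

/-- The plane rotation by a given angle. -/
def planeRotation (θ : ℝ) : SO2 :=
  ⟨⟨!![Real.cos θ, -Real.sin θ; Real.sin θ, Real.cos θ], by
    rw [Matrix.mem_unitaryGroup_iff, Matrix.star_eq_conjTranspose]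
    ext i j
    fin_cases i <;> fin_cases j <;>
      simp [Matrix.mul_apply, Fin.sum_univ_two, ← pow_two, mul_comm]⟩, by
    change Matrix.det _ = 1
    simp [Matrix.det_fin_two, ← pow_two]⟩

theorem continuous_planeRotation : Continuous planeRotation := by
  refine Continuous.subtype_mk (Continuous.subtype_mk ?_ _) _
  refine continuous_matrix fun i j => ?_
  fin_cases i <;> fin_cases j <;> simp <;> fun_prop

theorem planeRotation_two_pi : planeRotation (2 * Real.pi) = planeRotation 0 := by
  simp [planeRotation]

theorem SO2.sq_add_sq (A : SO2) : A.1.1 0 0 ^ 2 + A.1.1 1 0 ^ 2 = 1 := by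
  have := congrFun₂ (Matrix.mem_unitaryGroup_iff'.mp A.1.2) 0 0
  simpa [Matrix.mul_apply, Fin.sum_univ_two, ← pow_two] using this

/-- The identification of `SO(2)` with the unit circle. -/
def SO2.toCircle (A : SO2) : Circle :=
  ⟨⟨A.1.1 0 0, A.1.1 1 0⟩, by
    rw [Submonoid.unitSphere, Submonoid.mem_mk, Subsemigroup.mem_mk, mem_sphere_zero_iff_norm,
      Complex.norm_def, Complex.normSq_mk, ← pow_two, ← pow_two, SO2.sq_add_sq, Real.sqrt_one]⟩

theorem SO2.continuous_toCircle : Continuous SO2.toCircle := by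
  refine Continuous.subtype_mk ?_ _
  have hc : Continuous fun A : SO2 => A.1.1 := continuous_subtype_val.comp continuous_subtype_val
  exact Complex.equivRealProdCLM.symm.continuous.comp
    ((hc.matrix_elem 0 0).prodMk (hc.matrix_elem 1 0))

theorem SO2.toCircle_planeRotation (θ : ℝ) : SO2.toCircle (planeRotation θ) = Circle.exp θ := by
  ext
  rw [Circle.coe_exp]
  apply Complex.ext <;> simp [SO2.toCircle, planeRotation, Complex.exp_ofReal_mul_I_re,
    Complex.exp_ofReal_mul_I_im]

/-- SO(3) is not homeomorphic to SO(2) × S². -/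
theorem so3_not_homeomorphic_so2_prod_sphere : IsEmpty (SO3 ≃ₜ (SO2 × S2)) := by
  refine ⟨fun e => ?_⟩
  obtain ⟨g, hg, hgf⟩ := SO3.exists_circle_exp_comp_eq
    (SO2.continuous_toCircle.comp (continuous_fst.comp e.continuous))
  let p : S2 := ⟨EuclideanSpace.single 0 1, by simp⟩
  have h := sub_eq_sub_of_circle_exp_eq (g := fun θ => g (e.symm (planeRotation θ, p))) (h := id)
    (hg.comp (e.symm.continuous.comp (continuous_planeRotation.prodMk continuous_const)))
    continuous_id (fun θ => by
      rw [hgf]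
      simp [SO2.toCircle_planeRotation]) (2 * Real.pi) 0
  simp [planeRotation_two_pi, Real.pi_ne_zero] at h
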